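/- arXiv:2605.10505 — 2 statements merged into one kernel-verified Lean document; each statement's English description precedes it below -/
import Mathlib

section
/- In the human-LLM co-adaptation model, if α_H > 0, α_M > 0, and |1 - 2α_H - α_M| < 1, then both sequences converge to the common equilibrium value L = (α_M · x_0 + 2α_H · y_0)/(α_M + 2α_H): x_t → L and y_t → L as t → ∞; in particular the limits x* and y* coincide (stable communication emerges as a fixed point with x* = y*). -/
/-- In the human-LLM co-adaptation model, if `α_H > 0`, `α_M > 0`, and
`|1 - 2 α_H - α_M| < 1`, then both sequences converge to the common equilibrium
`L = (α_M * x 0 + 2 α_H * y 0) / (α_M + 2 α_H)`; in particular the limits coincide. -/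
theorem convergence_to_common_equilibrium
    (αH αM : ℝ) (x y : ℕ → ℝ)
    (hx : ∀ t, x (t + 1) = x t - 2 * αH * (x t - y t))
    (hy : ∀ t, y (t + 1) = y t + αM * (x t - y t))
    (hαH : 0 < αH) (hαM : 0 < αM)
    (hρ : |1 - 2 * αH - αM| < 1) :
    Filter.Tendsto x Filter.atTop
      (nhds ((αM * x 0 + 2 * αH * y 0) / (αM + 2 * αH))) ∧
    Filter.Tendsto y Filter.atTop
      (nhds ((αM * x 0 + 2 * αH * y 0) / (αM + 2 * αH))) := by
  have hS : αM + 2 * αH ≠ 0 := by positivity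
  have hd : ∀ t, x t - y t = (1 - 2 * αH - αM) ^ t * (x 0 - y 0) := by
    intro t
    induction t with
    | zero => simp
    | succ n ih =>
      rw [pow_succ]
      linear_combination hx n - hy n + (1 - 2 * αH - αM) * ih
  have hc : ∀ t, αM * x t + 2 * αH * y t = αM * x 0 + 2 * αH * y 0 := by
    intro t
    induction t with
    | zero => rfl
    | succ n ih => linear_combination αM * hx n + 2 * αH * hy n + ih
  have hlim := tendsto_pow_atTop_nhds_zero_of_abs_lt_one hρ
  have key : ∀ c : ℝ, Filter.Tendsto
      (fun t => (αM * x 0 + 2 * αH * y 0) / (αM + 2 * αH)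
        + (1 - 2 * αH - αM) ^ t * c) Filter.atTop
      (nhds ((αM * x 0 + 2 * αH * y 0) / (αM + 2 * αH))) := by
    intro c
    simpa using (hlim.mul_const c).const_add
      ((αM * x 0 + 2 * αH * y 0) / (αM + 2 * αH))
  constructor
  · refine (key (2 * αH * (x 0 - y 0) / (αM + 2 * αH))).congr fun t => ?_
    field_simp
    linear_combination -hc t - 2 * αH * hd t
  · refine (key (-(αM * (x 0 - y 0)) / (αM + 2 * αH))).congr fun t => ?_
    field_simp
    linear_combination -hc t + αM * hd t
end

section
/- Let α_H > 0 and α_M > 0 satisfy |1 - 2α_H - α_M| < 1, and let T : ℝ² → ℝ² be the co-adaptation update map T(x, y) = (x - 2α_H(x - y), y + α_M(x - y)). Then for every initial point (x_0, y_0) ∈ ℝ², the orbit (x_t, y_t) = T^t(x_0, y_0) converges to a fixed point of T lying on the diagonal; in particular, the difference x_t - y_t tends to 0 and the limits of x_t and y_t are equal. -/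
/-- For `α_H > 0`, `α_M > 0` with `|1 - 2 α_H - α_M| < 1`, every orbit of the
co-adaptation update map `T (x, y) = (x - 2 α_H (x - y), y + α_M (x - y))`
converges to a fixed point of `T` on the diagonal; in particular the difference
of the coordinates tends to `0` and the limits of the two coordinates coincide. -/
theorem orbit_converges_to_diagonal_fixed_point
    (αH αM : ℝ) (hαH : 0 < αH) (hαM : 0 < αM)
    (hρ : |1 - 2 * αH - αM| < 1)
    (T : ℝ × ℝ → ℝ × ℝ)
    (hT : ∀ p : ℝ × ℝ,
      T p = (p.1 - 2 * αH * (p.1 - p.2), p.2 + αM * (p.1 - p.2))) :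
    ∀ x₀ y₀ : ℝ, ∃ p : ℝ × ℝ, T p = p ∧ p.1 = p.2 ∧
      Filter.Tendsto (fun t : ℕ => T^[t] (x₀, y₀)) Filter.atTop (nhds p) ∧
      Filter.Tendsto (fun t : ℕ => (T^[t] (x₀, y₀)).1 - (T^[t] (x₀, y₀)).2)
        Filter.atTop (nhds 0) := by
  intro x₀ y₀
  have hs : 2 * αH + αM ≠ 0 := by positivity
  obtain ⟨s, hsd⟩ : ∃ s, s = 2 * αH + αM := ⟨_, rfl⟩
  obtain ⟨c, hc⟩ : ∃ c, c = (αM * x₀ + 2 * αH * y₀) / s := ⟨_, rfl⟩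
  obtain ⟨k, hk⟩ : ∃ k, k = (x₀ - y₀) / s := ⟨_, rfl⟩
  rw [← hsd] at hs
  have hform : ∀ t : ℕ, T^[t] (x₀, y₀) =
      (c + 2 * αH * k * (1 - 2 * αH - αM) ^ t, c - αM * k * (1 - 2 * αH - αM) ^ t) := by
    intro t
    induction t with
    | zero =>
      simp only [Function.iterate_zero, id, pow_zero, Prod.mk.injEq]
      rw [hc, hk]
      constructor <;> field_simp <;> rw [hsd] <;> ring
    | succ n ih =>
      rw [Function.iterate_succ_apply', ih, hT]
      simp only [Prod.mk.injEq]
      constructor <;> ring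
  have hpow := tendsto_pow_atTop_nhds_zero_of_abs_lt_one hρ
  have h1 : Filter.Tendsto (fun t : ℕ => c + 2 * αH * k * (1 - 2 * αH - αM) ^ t)
      Filter.atTop (nhds c) := by
    simpa using (hpow.const_mul (2 * αH * k)).const_add c
  have h2 : Filter.Tendsto (fun t : ℕ => c - αM * k * (1 - 2 * αH - αM) ^ t)
      Filter.atTop (nhds c) := by
    simpa using (hpow.const_mul (αM * k)).const_sub c
  refine ⟨(c, c), by simp [hT], rfl, ?_, ?_⟩
  · simp only [hform]
    exact h1.prodMk_nhds h2
  · simp only [hform]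
    simpa only [sub_self] using h1.sub h2
end
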